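/- arXiv:2501.11157 — 2 statements merged into one kernel-verified Lean document; each statement's English description precedes it below -/
import Mathlib

section
/- Every tree with at least two vertices and thinness at least k has at least (3^{k-1} + 3)/2 leaves. -/
open SimpleGraph

variable {V : Type*}

def Consistent (G : SimpleGraph V) (r : V → V → Prop) {k : ℕ} (C : V → Fin k) : Prop :=
  ∀ u v w, r u v → r v w → C u = C v → G.Adj u w → G.Adj v w

def IsKThin (G : SimpleGraph V) (k : ℕ) : Prop :=
  ∃ r : V → V → Prop, IsStrictTotalOrder V r ∧ ∃ C : V → Fin k, Consistent G r C

noncomputable def Thinness (G : SimpleGraph V) : ℕ := sInf {k | IsKThin G k}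

noncomputable def DanglingThin (G : SimpleGraph V) (v u : V) : ℕ :=
  Thinness (G.induce ((G.deleteEdges {s(v,u)}).connectedComponentMk u).supp)

def KNeighbor (G : SimpleGraph V) (k : ℕ) (x v : V) : Prop :=
  G.Adj x v ∧ ∃ u, G.Adj v u ∧ u ≠ x ∧ k ≤ DanglingThin G v u

def IsChild (G : SimpleGraph V) (rt x v : V) : Prop :=
  G.Adj x v ∧ G.dist rt x + 1 = G.dist rt v

def IsAncestor (G : SimpleGraph V) (rt v x : V) : Prop :=
  v ≠ x ∧ G.dist rt v + G.dist v x = G.dist rt x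

def Subtree (G : SimpleGraph V) (rt v : V) : Set V :=
  {w | G.dist rt v + G.dist v w = G.dist rt w}

def ChildKNeighbor (G : SimpleGraph V) (rt : V) (k : ℕ) (x v : V) : Prop :=
  IsChild G rt x v ∧ KNeighbor G k x v

noncomputable def Critical (G : SimpleGraph V) (rt x : V) : Prop :=
  {v | ChildKNeighbor G rt (Thinness G) x v}.ncard = 2


/-! ### Branches of a tree -/

/-- The branch hanging from `v` through its neighbour `u`. -/
def Br (G : SimpleGraph V) (v u : V) : Set V := {w | G.dist w u + 1 = G.dist w v}

theorem closer_unique {G : SimpleGraph V} (hT : G.IsTree) {w v a b : V} (ha : G.Adj v a)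
    (hb : G.Adj v b) (h1 : G.dist w a + 1 = G.dist w v) (h2 : G.dist w b + 1 = G.dist w v) :
    a = b := by
  have key : ∀ c, G.Adj v c → G.dist w c + 1 = G.dist w v →
      ∃ p : G.Walk w v, p.IsPath ∧ p.penultimate = c := by
    intro c hc h
    obtain ⟨p, hp⟩ := hT.connected.exists_walk_length_eq_dist w c
    refine ⟨p.concat hc.symm, ?_, by simp⟩
    apply Walk.isPath_of_length_eq_dist
    rw [Walk.length_concat, hp, h]
  obtain ⟨p, hp, rfl⟩ := key a ha h1
  obtain ⟨q, hq, rfl⟩ := key b hb h2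
  rw [(hT.existsUnique_path w v).unique hp hq]

theorem closer_exists {G : SimpleGraph V} (hT : G.IsTree) {w v : V} (h : w ≠ v) :
    ∃ u, G.Adj v u ∧ w ∈ Br G v u := by
  obtain ⟨p, hp⟩ := hT.connected.exists_walk_length_eq_dist v w
  cases p with
  | nil => exact absurd rfl h
  | @cons _ u _ ha q =>
    refine ⟨u, ha, ?_⟩
    have h1 := dist_le q
    rw [Walk.length_cons] at hp
    have h2 := hT.dist_eq_dist_add_one_of_adj w ha
    rw [SimpleGraph.dist_comm (u := w) (v := u), SimpleGraph.dist_comm (u := w) (v := v)] at h2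
    show G.dist w u + 1 = G.dist w v
    rw [SimpleGraph.dist_comm (u := w) (v := u), SimpleGraph.dist_comm (u := w) (v := v)]
    omega

theorem br_unique {G : SimpleGraph V} (hT : G.IsTree) {w v a b : V} (ha : G.Adj v a)
    (hb : G.Adj v b) (h1 : w ∈ Br G v a) (h2 : w ∈ Br G v b) : a = b :=
  closer_unique hT ha hb h1 h2

theorem br_compl {G : SimpleGraph V} (hT : G.IsTree) {w v u : V} (h : G.Adj v u) :
    w ∉ Br G v u ↔ w ∈ Br G u v := by
  have := hT.dist_eq_dist_add_one_of_adj w h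
  simp only [Br, Set.mem_ofPred_eq]
  omega

theorem self_mem_br {G : SimpleGraph V} {v u : V} (h : G.Adj v u) : u ∈ Br G v u := by
  have : G.dist u v = 1 := dist_eq_one_iff_adj.2 h.symm
  simp [Br, this]

theorem not_mem_br {G : SimpleGraph V} {v u : V} : v ∉ Br G v u := by
  simp [Br]

/-- Decomposition of a branch. -/
theorem mem_br_iff {G : SimpleGraph V} (hT : G.IsTree) {x v w : V} (h : G.Adj x v) :
    w ∈ Br G x v ↔ w = v ∨ ∃ u, G.Adj v u ∧ u ≠ x ∧ w ∈ Br G v u := by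
  constructor
  · intro hw
    by_cases hv : w = v
    · exact Or.inl hv
    · obtain ⟨u, hu, hwu⟩ := closer_exists hT hv
      refine Or.inr ⟨u, hu, ?_, hwu⟩
      rintro rfl
      exact (br_compl hT h).2 hwu hw
  · rintro (rfl | ⟨u, hu, hne, hwu⟩)
    · exact self_mem_br h
    · rw [← br_compl hT h.symm]
      intro hw
      exact hne (br_unique hT hu h.symm hwu hw)

theorem br_subset {G : SimpleGraph V} (hT : G.IsTree) {x v u : V} (h : G.Adj x v)
    (hu : G.Adj v u) (hne : u ≠ x) : Br G v u ⊆ Br G x v :=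
  fun _ hw => (mem_br_iff hT h).2 (Or.inr ⟨u, hu, hne, hw⟩)

/-- The only edge leaving a branch is the one to its attachment vertex. -/
theorem br_edge {G : SimpleGraph V} (hT : G.IsTree) {v u a b : V} (h : G.Adj v u)
    (hab : G.Adj a b) (ha : a ∈ Br G v u) (hb : b ∉ Br G v u) : a = u ∧ b = v := by
  have hb' := (br_compl hT h).1 hb
  have e1 := hT.dist_eq_dist_add_one_of_adj v hab
  have e2 := hT.dist_eq_dist_add_one_of_adj u hab
  simp only [Br, Set.mem_ofPred_eq] at ha hb'
  rw [SimpleGraph.dist_comm (u := a) (v := u), SimpleGraph.dist_comm (u := a) (v := v)] at ha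
  rw [SimpleGraph.dist_comm (u := b) (v := u), SimpleGraph.dist_comm (u := b) (v := v)] at hb'
  have hbv : b = v := by
    by_contra hne
    obtain ⟨c, hc, hcv⟩ := closer_exists hT (w := v) (v := b) (Ne.symm hne)
    have hcv' : G.dist v c + 1 = G.dist v b := hcv
    have e3 := hT.dist_eq_dist_add_one_of_adj u hc
    have e4 := hT.dist_eq_dist_add_one_of_adj c h
    rw [SimpleGraph.dist_comm (u := c) (v := u), SimpleGraph.dist_comm (u := c) (v := v)] at e4
    have : a = c := closer_unique hT (w := u) (v := b) hab.symm hc (by omega) (by omega)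
    subst this
    omega
  subst hbv
  refine ⟨?_, rfl⟩
  have : G.dist u a = 0 := by
    have := SimpleGraph.dist_self (G := G) (v := b)
    omega
  exact (hT.connected.dist_eq_zero_iff.1 this).symm

theorem br_isTree {G : SimpleGraph V} (hT : G.IsTree) {v u : V} (h : G.Adj v u) :
    (G.induce (Br G v u)).IsTree := by
  refine ⟨?_, hT.isAcyclic.induce _⟩
  rw [connected_iff_exists_forall_reachable]
  refine ⟨⟨u, self_mem_br h⟩, ?_⟩
  have key : ∀ n, ∀ w (hw : w ∈ Br G v u), G.dist u w = n →
      (G.induce (Br G v u)).Reachable ⟨u, self_mem_br h⟩ ⟨w, hw⟩ := by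
    intro n
    induction n with
    | zero =>
      intro w hw h0
      have := hT.connected.dist_eq_zero_iff.1 h0
      subst this
      exact Reachable.refl _
    | succ n ih =>
      intro w hw hn
      have hne : u ≠ w := by rintro rfl; simp at hn
      obtain ⟨c, hc, hcu⟩ := closer_exists hT hne
      have hcu' : G.dist u c + 1 = G.dist u w := hcu
      have hcB : c ∈ Br G v u := by
        by_contra hcB
        exact hne (br_edge hT h hc hw hcB).1.symm
      refine (ih c hcB (by omega)).trans (Adj.reachable ?_)
      exact hc.symm
  exact fun ⟨w, hw⟩ => key _ w hw rfl

/-! ### Layouts -/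

/-- `f` is a linear order on `S` and `C` a classification into `k` classes, consistent. -/
structure Lay (G : SimpleGraph V) (S : Set V) (k : ℕ) (f C : V → ℕ) : Prop where
  inj : Set.InjOn f S
  lt : ∀ v ∈ S, C v < k
  cons : ∀ u ∈ S, ∀ v ∈ S, ∀ w ∈ S, f u < f v → f v < f w → C u = C v → G.Adj u w → G.Adj v w

def SThin (G : SimpleGraph V) (S : Set V) (k : ℕ) : Prop := ∃ f C, Lay G S k f C

theorem Lay.mono {G : SimpleGraph V} {S S' : Set V} {k : ℕ} {f C : V → ℕ} (h : Lay G S k f C)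
    (hs : S' ⊆ S) : Lay G S' k f C :=
  ⟨h.inj.mono hs, fun v hv => h.lt v (hs hv), fun u hu v hv w hw =>
    h.cons u (hs hu) v (hs hv) w (hs hw)⟩

theorem SThin.mono {G : SimpleGraph V} {S S' : Set V} {k : ℕ} (h : SThin G S k)
    (hs : S' ⊆ S) : SThin G S' k := by
  obtain ⟨f, C, h⟩ := h
  exact ⟨f, C, h.mono hs⟩

theorem concat [Finite V] {G : SimpleGraph V} {S₁ S₂ : Set V} {k : ℕ} {f₁ C₁ f₂ C₂ : V → ℕ}
    (h₁ : Lay G S₁ k f₁ C₁) (h₂ : Lay G S₂ k f₂ C₂) (hd : ∀ v ∈ S₁, v ∉ S₂)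
    (hc : ∀ u ∈ S₁, ∀ w ∈ S₂, G.Adj u w →
      (∀ v ∈ S₁, f₁ u < f₁ v → C₁ u = C₁ v → G.Adj v w) ∧
      (∀ v ∈ S₂, f₂ v < f₂ w → C₁ u = C₂ v → G.Adj v w)) :
    ∃ f C, Lay G (S₁ ∪ S₂) k f C ∧ (∀ v ∈ S₁, C v = C₁ v) ∧ (∀ v ∈ S₂, C v = C₂ v) ∧
      (∀ u ∈ S₁, ∀ v ∈ S₁, f u < f v ↔ f₁ u < f₁ v) ∧
      (∀ u ∈ S₂, ∀ v ∈ S₂, f u < f v ↔ f₂ u < f₂ v) ∧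
      (∀ u ∈ S₁, ∀ v ∈ S₂, f u < f v) := by
  classical
  obtain ⟨M, hM⟩ : ∃ M, ∀ v, f₁ v < M := by
    obtain ⟨M, hM⟩ := (Set.finite_range f₁).bddAbove
    exact ⟨M + 1, fun v => Nat.lt_succ_of_le (hM ⟨v, rfl⟩)⟩
  obtain ⟨f, hf⟩ : ∃ f : V → ℕ, f = fun v => if v ∈ S₁ then f₁ v else f₂ v + M := ⟨_, rfl⟩
  obtain ⟨C, hC⟩ : ∃ C : V → ℕ, C = fun v => if v ∈ S₁ then C₁ v else C₂ v := ⟨_, rfl⟩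
  have f1 : ∀ v ∈ S₁, f v = f₁ v := fun v hv => by simp [hf, hv]
  have f2 : ∀ v ∈ S₂, f v = f₂ v + M := fun v hv => by
    have : v ∉ S₁ := fun h => hd v h hv
    simp [hf, this]
  have c1 : ∀ v ∈ S₁, C v = C₁ v := fun v hv => by simp [hC, hv]
  have c2 : ∀ v ∈ S₂, C v = C₂ v := fun v hv => by
    have : v ∉ S₁ := fun h => hd v h hv
    simp [hC, this]
  have o12 : ∀ u ∈ S₁, ∀ v ∈ S₂, f u < f v := fun u hu v hv => by
    rw [f1 u hu, f2 v hv]; have := hM u; omega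
  refine ⟨f, C, ⟨?_, ?_, ?_⟩, c1, c2, ?_, ?_, o12⟩
  · rintro a (ha | ha) b (hb | hb) hab
    · rw [f1 a ha, f1 b hb] at hab
      exact h₁.inj ha hb hab
    · exact absurd hab (o12 a ha b hb).ne
    · exact absurd hab (o12 b hb a ha).ne'
    · rw [f2 a ha, f2 b hb] at hab
      exact h₂.inj ha hb (by omega)
  · rintro v (hv | hv)
    · rw [c1 v hv]; exact h₁.lt v hv
    · rw [c2 v hv]; exact h₂.lt v hv
  · rintro u (hu | hu) v (hv | hv) w (hw | hw) huv hvw hcc hadj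
    · rw [f1 u hu, f1 v hv] at huv
      rw [f1 w hw, f1 v hv] at hvw
      rw [c1 u hu, c1 v hv] at hcc
      exact h₁.cons u hu v hv w hw huv hvw hcc hadj
    · rw [f1 u hu, f1 v hv] at huv
      rw [c1 u hu, c1 v hv] at hcc
      exact (hc u hu w hw hadj).1 v hv huv hcc
    · exact absurd hvw (o12 w hw v hv).not_gt
    · rw [f2 w hw, f2 v hv] at hvw
      rw [c1 u hu, c2 v hv] at hcc
      exact (hc u hu w hw hadj).2 v hv (by omega) hcc
    · exact absurd huv (o12 v hv u hu).not_gt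
    · exact absurd huv (o12 v hv u hu).not_gt
    · exact absurd hvw (o12 w hw v hv).not_gt
    · rw [f2 u hu, f2 v hv] at huv
      rw [f2 w hw, f2 v hv] at hvw
      rw [c2 u hu, c2 v hv] at hcc
      exact h₂.cons u hu v hv w hw (by omega) (by omega) hcc hadj
  · intro u hu v hv
    rw [f1 u hu, f1 v hv]
  · intro u hu v hv
    rw [f2 u hu, f2 v hv]
    omega

theorem forest [Finite V] {G : SimpleGraph V} (hT : G.IsTree) (y : V) (j : ℕ) (W : Finset V) :
    (∀ c ∈ W, G.Adj y c ∧ SThin G (Br G y c) j) → SThin G {w | ∃ c ∈ W, w ∈ Br G y c} j := by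
  classical
  induction W using Finset.induction_on with
  | empty =>
    intro _
    refine ⟨fun _ => 0, fun _ => 0, ?_, ?_, ?_⟩
    · rintro a ⟨c, hc, _⟩; simp at hc
    · rintro a ⟨c, hc, _⟩; simp at hc
    · rintro a ⟨c, hc, _⟩; simp at hc
  | @insert c W hcW ih =>
    intro h
    obtain ⟨f₂, C₂, h₂⟩ := ih (fun d hd => h d (Finset.mem_insert_of_mem hd))
    obtain ⟨hyc, f₁, C₁, h₁⟩ := h c (Finset.mem_insert_self _ _)
    have hdis : ∀ v ∈ Br G y c, v ∉ {w | ∃ c ∈ W, w ∈ Br G y c} := by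
      rintro v hv ⟨d, hd, hvd⟩
      have := br_unique hT hyc (h d (Finset.mem_insert_of_mem hd)).1 hv hvd
      exact hcW (this ▸ hd)
    obtain ⟨f, C, hL, -⟩ := concat h₁ h₂ hdis (by
      intro u hu w hw hadj
      exfalso
      have := br_edge hT hyc hadj hu (fun h => hdis w h hw)
      obtain ⟨d, hd, hwd⟩ := hw
      rw [this.2] at hwd
      exact not_mem_br hwd)
    refine ⟨f, C, hL.mono ?_⟩
    rintro w ⟨d, hd, hwd⟩
    rcases Finset.mem_insert.1 hd with rfl | hd
    · exact Or.inl hwd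
    · exact Or.inr ⟨d, hd, hwd⟩

/-- `v` is a `(j+1)`-neighbour of `x`. -/
def Heavy (G : SimpleGraph V) (j : ℕ) (x v : V) : Prop :=
  G.Adj x v ∧ ∃ u, G.Adj v u ∧ u ≠ x ∧ ¬ SThin G (Br G v u) j

theorem Heavy.not_sthin {G : SimpleGraph V} (hT : G.IsTree) {j : ℕ} {x v : V}
    (h : Heavy G j x v) : ¬ SThin G (Br G x v) j := by
  obtain ⟨hxv, u, hu, hne, hn⟩ := h
  exact fun hs => hn (hs.mono (br_subset hT hxv hu hne))

theorem Heavy.back {G : SimpleGraph V} (hT : G.IsTree) {j : ℕ} {x v u : V}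
    (h : Heavy G j v x) (hu : G.Adj v u) (hne : u ≠ x) : Heavy G j u v :=
  ⟨hu.symm, x, h.1, hne.symm, h.not_sthin hT⟩

/-- A layout of a light branch. -/
theorem block [Finite V] {G : SimpleGraph V} (hT : G.IsTree) {j : ℕ} {r y : V}
    (hry : G.Adj r y) (hh : ¬ Heavy G j r y) :
    ∃ f C, Lay G (Br G r y) (j + 1) f C ∧ ∀ v ∈ Br G r y, C v = 0 ↔ v = y := by
  classical
  have := Fintype.ofFinite V
  obtain ⟨f₂, C₂, h₂⟩ := forest hT y j (Finset.univ.filter (fun c => G.Adj y c ∧ c ≠ r)) (by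
    intro c hc
    simp only [Finset.mem_filter, Finset.mem_univ, true_and] at hc
    refine ⟨hc.1, ?_⟩
    by_contra hn
    exact hh ⟨hry, c, hc.1, hc.2, hn⟩)
  have hS : ∀ w, w ∈ {w | ∃ c ∈ (Finset.univ.filter (fun c => G.Adj y c ∧ c ≠ r)), w ∈ Br G y c} ↔
      ∃ u, G.Adj y u ∧ u ≠ r ∧ w ∈ Br G y u := by
    intro w
    simp [and_assoc]
  generalize {w | ∃ c ∈ (Finset.univ.filter (fun c => G.Adj y c ∧ c ≠ r)), w ∈ Br G y c} = S at *
  have h₂' : Lay G S (j + 1) f₂ (fun v => C₂ v + 1) :=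
    ⟨h₂.inj, fun v hv => Nat.succ_lt_succ (h₂.lt v hv),
      fun u hu v hv w hw a b c d => h₂.cons u hu v hv w hw a b (Nat.succ_injective c) d⟩
  have h₁ : Lay G {y} (j + 1) (fun _ => 0) (fun _ => 0) := by
    refine ⟨by simp, by simp, ?_⟩
    intro u hu v hv w hw a
    simp at a
  have hyS : y ∉ S := by
    intro h
    obtain ⟨u, -, -, h⟩ := (hS y).1 h
    exact not_mem_br h
  obtain ⟨f, C, hL, hc1, hc2, -⟩ := concat h₁ h₂' (by rintro v rfl; exact hyS) (by
    intro u hu w hw hadj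
    refine ⟨?_, ?_⟩
    · intro v hv a; simp at a
    · intro v hv a b
      simp at b)
  refine ⟨f, C, hL.mono ?_, ?_⟩
  · intro w hw
    rcases (mem_br_iff hT hry).1 hw with h | h
    · exact Or.inl h
    · exact Or.inr ((hS w).2 h)
  · intro v hv
    rcases (mem_br_iff hT hry).1 hv with h | h
    · exact ⟨fun _ => h, fun _ => hc1 v h⟩
    · have h' := (hS v).2 h
      rw [hc2 v h']
      simp
      rintro rfl
      exact hyS h'

theorem blocks [Finite V] {G : SimpleGraph V} (hT : G.IsTree) (j : ℕ) (r : V) (Y : Finset V) :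
    (∀ y ∈ Y, G.Adj r y ∧ ¬ Heavy G j r y) →
    ∃ f C, Lay G {w | ∃ y ∈ Y, w ∈ Br G r y} (j + 1) f C ∧
      ∀ v ∈ {w | ∃ y ∈ Y, w ∈ Br G r y}, C v = 0 ↔ G.Adj v r := by
  classical
  induction Y using Finset.induction_on with
  | empty =>
    intro _
    refine ⟨fun _ => 0, fun _ => 0, ⟨?_, ?_, ?_⟩, ?_⟩
    · rintro a ⟨c, hc, _⟩; simp at hc
    · rintro a ⟨c, hc, _⟩; simp at hc
    · rintro a ⟨c, hc, _⟩; simp at hc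
    · rintro a ⟨c, hc, _⟩; simp at hc
  | @insert y Y hyY ih =>
    intro h
    obtain ⟨f₂, C₂, h₂, e₂⟩ := ih (fun d hd => h d (Finset.mem_insert_of_mem hd))
    obtain ⟨hry, hh⟩ := h y (Finset.mem_insert_self _ _)
    obtain ⟨f₁, C₁, h₁, e₁⟩ := block hT hry hh
    have hdis : ∀ v ∈ Br G r y, v ∉ {w | ∃ y ∈ Y, w ∈ Br G r y} := by
      rintro v hv ⟨d, hd, hvd⟩
      have := br_unique hT hry (h d (Finset.mem_insert_of_mem hd)).1 hv hvd
      exact hyY (this ▸ hd)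
    obtain ⟨f, C, hL, hc1, hc2, -⟩ := concat h₁ h₂ hdis (by
      intro u hu w hw hadj
      exfalso
      have := br_edge hT hry hadj hu (fun h => hdis w h hw)
      obtain ⟨d, hd, hwd⟩ := hw
      rw [this.2] at hwd
      exact not_mem_br hwd)
    have hsub : ∀ w ∈ {w | ∃ z ∈ insert y Y, w ∈ Br G r z},
        w ∈ Br G r y ∪ {w | ∃ y ∈ Y, w ∈ Br G r y} := by
      rintro w ⟨d, hd, hwd⟩
      rcases Finset.mem_insert.1 hd with rfl | hd
      · exact Or.inl hwd
      · exact Or.inr ⟨d, hd, hwd⟩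
    refine ⟨f, C, hL.mono hsub, ?_⟩
    intro v hv
    rcases hsub v hv with h' | h'
    · rw [hc1 v h', e₁ v h']
      constructor
      · rintro rfl; exact hry.symm
      · intro hv
        exact (br_edge hT hry hv h' not_mem_br).1
    · rw [hc2 v h', e₂ v h']

/-- `v` comes last. -/
def PA (S : Set V) (v : V) (f C : V → ℕ) : Prop :=
  v ∈ S ∧ C v = 0 ∧ ∀ w ∈ S, f w ≤ f v

/-- Only neighbours of `v` come before `v` in the class of `v`. -/
def PB (G : SimpleGraph V) (S : Set V) (v : V) (f C : V → ℕ) : Prop :=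
  v ∈ S ∧ C v = 0 ∧ ∀ w ∈ S, f w < f v → C w = 0 → G.Adj w v

theorem star [Finite V] {G : SimpleGraph V} (hT : G.IsTree) (j : ℕ) (r : V) (Y : Set V)
    (hY : ∀ y ∈ Y, G.Adj r y ∧ ¬ Heavy G j r y) :
    ∃ f C, Lay G ({w | ∃ y ∈ Y, w ∈ Br G r y} ∪ {r}) (j + 1) f C ∧
      PA ({w | ∃ y ∈ Y, w ∈ Br G r y} ∪ {r}) r f C ∧
      PB G ({w | ∃ y ∈ Y, w ∈ Br G r y} ∪ {r}) r f C := by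
  classical
  obtain ⟨f₁, C₁, h₁, e₁⟩ := blocks hT j r Y.toFinite.toFinset (by simpa using hY)
  simp only [Set.Finite.mem_toFinset] at h₁ e₁
  have hr : r ∉ {w | ∃ y ∈ Y, w ∈ Br G r y} := by
    rintro ⟨y, -, h⟩
    exact not_mem_br h
  generalize {w | ∃ y ∈ Y, w ∈ Br G r y} = S at *
  have h₂ : Lay G {r} (j + 1) (fun _ => 0) (fun _ => 0) := by
    refine ⟨by simp, by simp, ?_⟩
    intro u hu v hv w hw a
    simp at a
  obtain ⟨f, C, hL, hc1, hc2, ho1, ho2, ho⟩ := concat h₁ h₂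
      (by rintro v hv rfl; exact hr hv) (by
    rintro u hu w rfl hadj
    refine ⟨?_, ?_⟩
    · intro v hv a b
      rw [(e₁ u hu).2 hadj] at b
      exact (e₁ v hv).1 b.symm
    · intro v hv a
      simp at a)
  have c0 : C r = 0 := hc2 r rfl
  refine ⟨f, C, hL, ⟨Or.inr rfl, c0, ?_⟩, Or.inr rfl, c0, ?_⟩
  · rintro w (hw | rfl)
    · exact (ho w hw r rfl).le
    · exact le_rfl
  · rintro w (hw | rfl) h h0
    · rw [hc1 w hw] at h0
      exact (e₁ w hw).1 h0
    · exact absurd h (lt_irrefl _)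

theorem join [Finite V] {G : SimpleGraph V} {S₁ S₂ : Set V} {k : ℕ} {f₁ C₁ f₂ C₂ : V → ℕ}
    {r₁ r₂ : V}
    (h₁ : Lay G S₁ k f₁ C₁) (h₂ : Lay G S₂ k f₂ C₂) (hd : ∀ v ∈ S₁, v ∉ S₂)
    (ha : PA S₁ r₁ f₁ C₁) (hb : PB G S₂ r₂ f₂ C₂)
    (hc : ∀ u ∈ S₁, ∀ w ∈ S₂, G.Adj u w → u = r₁ ∧ w = r₂) :
    ∃ f C, Lay G (S₁ ∪ S₂) k f C ∧ (PA S₂ r₂ f₂ C₂ → PA (S₁ ∪ S₂) r₂ f C) ∧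
      (PB G S₁ r₁ f₁ C₁ → PB G (S₁ ∪ S₂) r₁ f C) := by
  obtain ⟨f, C, hL, hc1, hc2, ho1, ho2, ho⟩ := concat h₁ h₂ hd (by
    intro u hu w hw hadj
    obtain ⟨rfl, rfl⟩ := hc u hu w hw hadj
    refine ⟨?_, ?_⟩
    · intro v hv a
      exact absurd a (ha.2.2 v hv).not_gt
    · intro v hv a b
      exact hb.2.2 v hv a (b.symm.trans ha.2.1))
  refine ⟨f, C, hL, ?_, ?_⟩
  · rintro ⟨m, c, l⟩
    refine ⟨Or.inr m, by rw [hc2 _ m, c], ?_⟩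
    rintro w (hw | hw)
    · exact (ho w hw _ m).le
    · have := ho2 _ m w hw
      have := l w hw
      omega
  · rintro ⟨m, c, l⟩
    refine ⟨Or.inl m, by rw [hc1 _ m, c], ?_⟩
    rintro w (hw | hw) hlt h0
    · exact l w hw ((ho1 _ hw _ m).1 hlt) (by rw [← hc1 w hw, h0])
    · exact absurd hlt (ho _ m w hw).not_gt

theorem spine [Finite V] {G : SimpleGraph V} (hT : G.IsTree) (j : ℕ)
    (h3 : ∀ x a b c, Heavy G j x a → Heavy G j x b → Heavy G j x c → a = b ∨ a = c ∨ b = c) :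
    ∀ n x v, (Br G x v).ncard = n → Heavy G j v x →
      (∃ f C, Lay G (Br G x v) (j + 1) f C ∧ PA (Br G x v) v f C) ∧
      (∃ f C, Lay G (Br G x v) (j + 1) f C ∧ PB G (Br G x v) v f C) := by
  intro n
  induction n using Nat.strong_induction_on with
  | _ n ih =>
  intro x v hn hvx
  have hxv := hvx.1.symm
  by_cases hex : ∃ u, u ≠ x ∧ Heavy G j v u
  · obtain ⟨u, hux, hvu⟩ := hex
    have hadj := hvu.1
    obtain ⟨f₀, C₀, h₀, a₀, b₀⟩ := star hT j v {y | G.Adj v y ∧ y ≠ x ∧ y ≠ u} (by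
      rintro y ⟨hy, hyx, hyu⟩
      refine ⟨hy, fun hvy => ?_⟩
      rcases h3 v x u y hvx hvu hvy with h | h | h
      · exact hux h.symm
      · exact hyx h.symm
      · exact hyu h.symm)
    have hcard : (Br G v u).ncard < n := by
      rw [← hn]
      apply Set.ncard_lt_ncard _ (Set.toFinite _)
      refine ⟨br_subset hT hxv hadj hux, fun h => ?_⟩
      exact not_mem_br (h (self_mem_br hxv))
    obtain ⟨⟨f₁, C₁, h₁, a₁⟩, f₂, C₂, h₂, b₂⟩ := ih _ hcard v u rfl (hvx.back hT hadj hux)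
    have hS : ∀ w, w ∈ ({w | ∃ y ∈ {y | G.Adj v y ∧ y ≠ x ∧ y ≠ u}, w ∈ Br G v y} ∪ {v}) ↔
        w ∈ Br G x v ∧ w ∉ Br G v u := by
      intro w
      constructor
      · rintro (⟨y, ⟨hy, hyx, hyu⟩, hw⟩ | rfl)
        · exact ⟨br_subset hT hxv hy hyx hw, fun h => hyu (br_unique hT hy hadj hw h)⟩
        · exact ⟨self_mem_br hxv, not_mem_br⟩
      · rintro ⟨h1, h2⟩
        rcases (mem_br_iff hT hxv).1 h1 with h | ⟨y, hy, hyx, hw⟩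
        · exact Or.inr h
        · refine Or.inl ⟨y, ⟨hy, hyx, ?_⟩, hw⟩
          rintro rfl
          exact h2 hw
    generalize ({w | ∃ y ∈ {y | G.Adj v y ∧ y ≠ x ∧ y ≠ u}, w ∈ Br G v y} ∪ {v}) = S at *
    have hU : Br G v u ∪ S = Br G x v := by
      ext w
      have := @br_subset _ _ hT _ _ _ hxv hadj hux w
      simp only [Set.mem_union, hS]
      tauto
    constructor
    · obtain ⟨f, C, hL, hA, -⟩ := join h₁ h₀ (fun w hw h => ((hS w).1 h).2 hw) a₁ b₀ (by
        intro a ha b hb hab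
        exact br_edge hT hadj hab ha ((hS b).1 hb).2)
      rw [hU] at hL hA
      exact ⟨f, C, hL, hA a₀⟩
    · obtain ⟨f, C, hL, -, hB⟩ := join h₀ h₂ (fun w hw h => ((hS w).1 hw).2 h) a₀ b₂ (by
        intro a ha b hb hab
        exact (br_edge hT hadj hab.symm hb ((hS a).1 ha).2).symm)
      rw [Set.union_comm, hU] at hL hB
      exact ⟨f, C, hL, hB b₀⟩
  · obtain ⟨f₀, C₀, h₀, a₀, b₀⟩ := star hT j v {y | G.Adj v y ∧ y ≠ x} (by
      rintro y ⟨hy, hyx⟩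
      exact ⟨hy, fun hvy => hex ⟨y, hyx, hvy⟩⟩)
    have hS : ({w | ∃ y ∈ {y | G.Adj v y ∧ y ≠ x}, w ∈ Br G v y} ∪ {v}) = Br G x v := by
      ext w
      rw [mem_br_iff hT hxv]
      simp [and_assoc]
    rw [hS] at h₀ a₀ b₀
    exact ⟨⟨f₀, C₀, h₀, a₀⟩, f₀, C₀, h₀, b₀⟩

theorem thin_of_no_three [Finite V] {G : SimpleGraph V} (hT : G.IsTree) (j : ℕ)
    (h3 : ∀ x a b c, Heavy G j x a → Heavy G j x b → Heavy G j x c → a = b ∨ a = c ∨ b = c) :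
    SThin G Set.univ (j + 1) := by
  have hlight : ∀ v, (∀ u, ¬ Heavy G j v u) → SThin G Set.univ (j + 1) := by
    intro v hv
    obtain ⟨f₀, C₀, h₀, -⟩ := star hT j v {y | G.Adj v y} (fun y hy => ⟨hy, hv y⟩)
    refine ⟨f₀, C₀, h₀.mono ?_⟩
    intro w _
    by_cases hw : w = v
    · exact Or.inr hw
    · exact Or.inl (closer_exists hT hw)
  by_cases hex : ∃ n x v, (Br G x v).ncard = n ∧ Heavy G j x v
  · classical
    have hmin := fun m => Nat.find_min hex (m := m)
    obtain ⟨x, v, hn, hxv⟩ := Nat.find_spec hex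
    have hadj := hxv.1
    by_cases hvx : Heavy G j v x
    · obtain ⟨⟨f₁, C₁, h₁, a₁⟩, -⟩ := spine hT j h3 _ x v rfl hvx
      obtain ⟨-, f₂, C₂, h₂, b₂⟩ := spine hT j h3 _ v x rfl hxv
      obtain ⟨f, C, hL, -⟩ := join h₁ h₂
        (fun w hw => (br_compl hT hadj.symm).2 hw) a₁ b₂ (by
          intro a ha b hb hab
          exact br_edge hT hadj hab ha ((br_compl hT hadj).2 hb))
      refine ⟨f, C, hL.mono ?_⟩
      intro w _
      by_cases hw : w ∈ Br G x v
      · exact Or.inl hw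
      · exact Or.inr ((br_compl hT hadj).1 hw)
    · refine hlight v (fun u hu => ?_)
      have hux : u ≠ x := by rintro rfl; exact hvx hu
      refine hmin (Br G v u).ncard ?_ ⟨v, u, rfl, hu⟩
      rw [← hn]
      apply Set.ncard_lt_ncard _ (Set.toFinite _)
      refine ⟨br_subset hT hadj hu.1 hux, fun h => ?_⟩
      exact not_mem_br (h (self_mem_br hadj))
  · obtain ⟨v⟩ := hT.connected.nonempty
    exact hlight v (fun u hu => hex ⟨_, v, u, rfl, hu⟩)

/-! ### Counting leaves -/

def Leaves (G : SimpleGraph V) : Set V := {v | (G.neighborSet v).ncard = 1}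

theorem two_leaves [Finite V] [Nontrivial V] {G : SimpleGraph V} (hT : G.IsTree) :
    2 ≤ (Leaves G).ncard := by
  classical
  have := Fintype.ofFinite V
  obtain ⟨u, v, hne, hu, hv⟩ := hT.exists_ne_and_degree_eq_one
  have key : ∀ w, G.degree w = 1 → w ∈ Leaves G := by
    intro w hw
    show (G.neighborSet w).ncard = 1
    rw [Set.ncard_eq_toFinset_card', ← hw]
    rfl
  exact (Set.one_lt_ncard (Set.toFinite _)).2 ⟨u, key u hu, v, key v hv, hne⟩

theorem sthin_induce {G : SimpleGraph V} {B : Set V} {j : ℕ}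
    (h : SThin (G.induce B) Set.univ j) : SThin G B j := by
  classical
  obtain ⟨f, C, h⟩ := h
  refine ⟨fun v => if hv : v ∈ B then f ⟨v, hv⟩ else 0,
    fun v => if hv : v ∈ B then C ⟨v, hv⟩ else 0, ?_, ?_, ?_⟩
  · intro a ha b hb hab
    simp only [ha, hb, dif_pos] at hab
    exact congrArg Subtype.val (h.inj (Set.mem_univ _) (Set.mem_univ _) hab)
  · intro v hv
    simp only [hv, dif_pos]
    exact h.lt _ (Set.mem_univ _)
  · intro u hu v hv w hw
    simp only [hu, hv, hw, dif_pos]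
    exact h.cons ⟨u, hu⟩ trivial ⟨v, hv⟩ trivial ⟨w, hw⟩ trivial

theorem branch_leaves [Finite V] {G : SimpleGraph V} (hT : G.IsTree) {j : ℕ} {v u : V}
    (hvu : G.Adj v u) (hn : ¬ SThin G (Br G v u) j)
    (ih : Nontrivial (Br G v u) → (3 ^ j + 3) / 2 ≤ (Leaves (G.induce (Br G v u))).ncard) :
    (3 ^ j + 1) / 2 ≤ (Leaves G ∩ Br G v u).ncard := by
  by_cases hnt : Nontrivial (Br G v u)
  · have h1 := ih hnt
    have hsub : (Subtype.val '' (Leaves (G.induce (Br G v u)))) \ {u} ⊆ Leaves G ∩ Br G v u := by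
      rintro _ ⟨⟨⟨w, hw⟩, hl, rfl⟩, hne⟩
      refine ⟨?_, hw⟩
      have hl' : ((G.induce (Br G v u)).neighborSet ⟨w, hw⟩).ncard = 1 := hl
      show (G.neighborSet w).ncard = 1
      rw [← hl', ← Set.ncard_image_of_injective _ Subtype.val_injective]
      congr 1
      ext z
      constructor
      · intro hz
        have hz' : G.Adj w z := hz
        have hzB : z ∈ Br G v u := by
          by_contra hzB
          exact hne (br_edge hT hvu hz' hw hzB).1
        exact ⟨⟨z, hzB⟩, hz', rfl⟩
      · rintro ⟨⟨z, hzB⟩, hz, rfl⟩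
        exact hz
    have h2 := Set.ncard_le_ncard hsub (Set.toFinite _)
    have h3 := Set.pred_ncard_le_ncard_sdiff_singleton
      (Subtype.val '' (Leaves (G.induce (Br G v u)))) u
    rw [Set.ncard_image_of_injective _ Subtype.val_injective] at h3
    omega
  · have hs : ∀ w ∈ Br G v u, w = u := by
      intro w hw
      by_contra hne
      exact hnt ⟨⟨w, hw⟩, ⟨u, self_mem_br hvu⟩, fun h => hne (congrArg Subtype.val h)⟩
    have hj : j = 0 := by
      by_contra hj
      refine hn ⟨fun _ => 0, fun _ => 0, ?_, ?_, ?_⟩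
      · intro a ha b hb _
        rw [hs a ha, hs b hb]
      · intro _ _; omega
      · intro _ _ _ _ _ _ h
        exact absurd h (lt_irrefl _)
    subst hj
    have : u ∈ Leaves G ∩ Br G v u := by
      refine ⟨?_, self_mem_br hvu⟩
      show (G.neighborSet u).ncard = 1
      rw [Set.ncard_eq_one]
      refine ⟨v, ?_⟩
      ext z
      constructor
      · intro hz
        have hz' : G.Adj u z := hz
        refine (br_edge hT hvu hz' (self_mem_br hvu) ?_).2
        intro h
        exact hz'.ne (hs z h).symm
      · rintro rfl
        exact hvu.symm
    have := (Set.ncard_pos (Set.toFinite _)).2 ⟨u, this⟩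
    exact this

theorem leaves_aux.{u} (j : ℕ) : ∀ (W : Type u) [Finite W] [Nontrivial W] (G : SimpleGraph W),
    G.IsTree → ¬ SThin G Set.univ j → (3 ^ j + 3) / 2 ≤ (Leaves G).ncard := by
  induction j with
  | zero =>
    intro W _ _ G hT _
    exact two_leaves hT
  | succ j ih =>
    intro W _ _ G hT hn
    have hex : ∃ x a b c, Heavy G j x a ∧ Heavy G j x b ∧ Heavy G j x c ∧
        a ≠ b ∧ a ≠ c ∧ b ≠ c := by
      by_contra hex
      refine hn (thin_of_no_three hT j ?_)
      intro x a b c ha hb hc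
      by_contra hne
      push Not at hne
      exact hex ⟨x, a, b, c, ha, hb, hc, hne⟩
    obtain ⟨x, a, b, c, ha, hb, hc, hab, hac, hbc⟩ := hex
    have key : ∀ v, Heavy G j x v → (3 ^ j + 1) / 2 ≤ (Leaves G ∩ Br G x v).ncard := by
      rintro v ⟨hxv, u, hvu, hne, hnt⟩
      have h1 := branch_leaves hT hvu hnt (fun _ => ih _ _ (br_isTree hT hvu)
        (fun h => hnt (sthin_induce h)))
      exact h1.trans (Set.ncard_le_ncard
        (Set.inter_subset_inter_right _ (br_subset hT hxv hvu hne)) (Set.toFinite _))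
    have hdis : ∀ v w, Heavy G j x v → Heavy G j x w → v ≠ w →
        Disjoint (Leaves G ∩ Br G x v) (Leaves G ∩ Br G x w) := by
      intro v w hv hw hne
      rw [Set.disjoint_left]
      rintro z ⟨-, h1⟩ ⟨-, h2⟩
      exact hne (br_unique hT hv.1 hw.1 h1 h2)
    have hsum : (Leaves G ∩ Br G x a).ncard + (Leaves G ∩ Br G x b).ncard
        + (Leaves G ∩ Br G x c).ncard ≤ (Leaves G).ncard := by
      rw [← Set.ncard_union_eq (hdis a b ha hb hab) (Set.toFinite _) (Set.toFinite _),
        ← Set.ncard_union_eq (Set.disjoint_union_left.2 ⟨hdis a c ha hc hac, hdis b c hb hc hbc⟩)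
          (Set.toFinite _) (Set.toFinite _)]
      apply Set.ncard_le_ncard _ (Set.toFinite _)
      rintro z ((h | h) | h) <;> exact h.1
    have h1 := key a ha
    have h2 := key b hb
    have h3 := key c hc
    have hodd : 3 ^ j % 2 = 1 := by
      rw [Nat.pow_mod]; simp
    rw [pow_succ]
    omega

theorem thinness_le_of_sthin {G : SimpleGraph V} {j : ℕ} (h : SThin G Set.univ j) :
    Thinness G ≤ j := by
  obtain ⟨f, C, h⟩ := h
  apply Nat.sInf_le
  refine ⟨fun u v => f u < f v, ?_, fun v => ⟨C v, h.lt v trivial⟩, ?_⟩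
  · have hinj : Function.Injective f := fun a b hab => h.inj trivial trivial hab
    exact RelEmbedding.isStrictTotalOrder (s := ((· < ·) : ℕ → ℕ → Prop))
      ⟨⟨f, hinj⟩, Iff.rfl⟩
  · intro u v w huv hvw hc hadj
    exact h.cons u trivial v trivial w trivial huv hvw (congrArg Fin.val hc) hadj

theorem leaves_lower_bound [Fintype V] (G : SimpleGraph V) (hT : G.IsTree)
    (hn : 2 ≤ Fintype.card V) (k : ℕ) (hk : k ≤ Thinness G) :
    (3 ^ (k - 1) + 3) / 2 ≤ {v | (G.neighborSet v).ncard = 1}.ncard := by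
  have : Nontrivial V := Fintype.one_lt_card_iff_nontrivial.1 hn
  refine leaves_aux (k - 1) V G hT ?_
  intro h
  rcases Nat.eq_zero_or_pos k with rfl | hpos
  · obtain ⟨v⟩ := hT.connected.nonempty
    obtain ⟨f, C, h⟩ := h
    exact absurd (h.lt v trivial) (Nat.not_lt_zero _)
  · have := thinness_le_of_sthin h
    omega
end

section
/- Every rooted tree with thinness k has at most one critical vertex, i.e., at most one vertex having exactly two children that are k-neighbors. -/
open SimpleGraph

variable {V : Type*}

/-- Dilworth's theorem, via Galvin's argument. -/
theorem dilworth_aux {α : Type*} [PartialOrder α] (n : ℕ) : ∀ s : Finset α, s.card = n →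
    ∃ A ⊆ s, (∀ a ∈ A, ∀ b ∈ A, a ≤ b → a = b) ∧
      ∃ f : α → ℕ, (∀ z ∈ s, f z < A.card) ∧
        ∀ z ∈ s, ∀ y ∈ s, f z = f y → z ≤ y ∨ y ≤ z := by
  classical
  induction n using Nat.strong_induction_on with
  | _ n ih =>
  intro s hs
  rcases s.eq_empty_or_nonempty with rfl | hne
  · exact ⟨∅, by simp, by simp, fun _ => 0, by simp, by simp⟩
  obtain ⟨a, has, hamax⟩ := s.exists_maximal hne
  have hamax' : ∀ z ∈ s, a ≤ z → z = a := fun z hz h => le_antisymm (hamax hz h) h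
  obtain ⟨A0, hA0s, hA0, f, hf, hfc⟩ := ih (s.erase a).card
    (hs ▸ Finset.card_erase_lt_of_mem has) (s.erase a) rfl
  set m := A0.card with hm
  -- every antichain of size m hits every colour
  have hit : ∀ B ⊆ s.erase a, (∀ p ∈ B, ∀ q ∈ B, p ≤ q → p = q) → B.card = m →
      ∀ i < m, ∃ z ∈ B, f z = i := by
    intro B hB hBa hBm i hi
    have hinj : Set.InjOn f B := by
      intro p hp q hq hpq
      rcases hfc p (hB hp) q (hB hq) hpq with h | h
      · exact hBa p hp q hq h
      · exact (hBa q hq p hp h).symm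
    have himg : B.image f = Finset.range m := by
      apply Finset.eq_of_subset_of_card_le
      · intro j hj
        obtain ⟨z, hz, rfl⟩ := Finset.mem_image.1 hj
        exact Finset.mem_range.2 (hf z (hB hz))
      · rw [Finset.card_image_of_injOn hinj, hBm, Finset.card_range]
    have : i ∈ B.image f := by rw [himg]; exact Finset.mem_range.2 hi
    simpa using this
  let good : α → Prop := fun z => ∃ B ⊆ s.erase a,
    (∀ p ∈ B, ∀ q ∈ B, p ≤ q → p = q) ∧ B.card = m ∧ z ∈ B
  have hx : ∀ i : Fin m, ∃ z ∈ s.erase a, f z = i ∧ good z ∧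
      ∀ y ∈ s.erase a, f y = i → good y → y ≤ z := by
    intro i
    obtain ⟨z0, hz0, hz0i⟩ := hit A0 hA0s hA0 rfl i i.2
    obtain ⟨z, hz, hzm⟩ := ((s.erase a).filter (fun z => f z = i ∧ good z)).exists_maximal
      ⟨z0, Finset.mem_filter.2 ⟨hA0s hz0, hz0i, A0, hA0s, hA0, rfl, hz0⟩⟩
    rw [Finset.mem_filter] at hz
    refine ⟨z, hz.1, hz.2.1, hz.2.2, fun y hy hyi hyg => ?_⟩
    rcases hfc y hy z hz.1 (hyi.trans hz.2.1.symm) with h | h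
    · exact h
    · exact hzm (Finset.mem_filter.2 ⟨hy, hyi, hyg⟩) h
  choose x hxs hxf hxg hxmax using hx
  have hxanti : ∀ i j, x i ≤ x j → i = j := by
    intro i j hij
    obtain ⟨B, hB, hBa, hBm, hjB⟩ := hxg j
    obtain ⟨y, hy, hyi⟩ := hit B hB hBa hBm i i.2
    have h1 : y ≤ x i := hxmax i y (hB hy) hyi ⟨B, hB, hBa, hBm, hy⟩
    have h2 := hBa y hy _ hjB (h1.trans hij)
    apply Fin.ext
    rw [← hyi, h2, hxf]
  have hxinj : Function.Injective x := fun i j h => hxanti i j h.le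
  let A : Finset α := Finset.univ.image x
  have hAcard : A.card = m := by
    simp only [A]; rw [Finset.card_image_of_injective _ hxinj]; simp
  have hAs : A ⊆ s.erase a := by
    intro z hz
    obtain ⟨i, -, rfl⟩ := Finset.mem_image.1 hz
    exact hxs i
  have hAa : ∀ p ∈ A, ∀ q ∈ A, p ≤ q → p = q := by
    intro p hp q hq h
    obtain ⟨i, -, rfl⟩ := Finset.mem_image.1 hp
    obtain ⟨j, -, rfl⟩ := Finset.mem_image.1 hq
    rw [hxanti i j h]
  by_cases hc : ∃ i, x i ≤ a
  · obtain ⟨i, hi⟩ := hc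
    have him : 0 < m := lt_of_le_of_lt (Nat.zero_le _) i.2
    let K : α → Prop := fun z => z = a ∨ (f z = i ∧ z ≤ x i)
    let t := s.filter (fun z => ¬ K z)
    have hts : t ⊆ s.erase a := by
      intro z hz
      rw [Finset.mem_filter] at hz
      exact Finset.mem_erase.2 ⟨fun h => hz.2 (Or.inl h), hz.1⟩
    obtain ⟨A', hA's, hA', f', hf', hfc'⟩ := ih t.card
      (hs ▸ (Finset.card_le_card hts).trans_lt (Finset.card_erase_lt_of_mem has)) t rfl
    have hlt : A'.card < m := by
      by_contra hge
      push Not at hge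
      obtain ⟨B, hBA, hBm⟩ := Finset.exists_subset_card_eq hge
      have hBs : B ⊆ s.erase a := hBA.trans (hA's.trans hts)
      have hBa : ∀ p ∈ B, ∀ q ∈ B, p ≤ q → p = q :=
        fun p hp q hq => hA' p (hBA hp) q (hBA hq)
      obtain ⟨y, hy, hyi⟩ := hit B hBs hBa hBm i i.2
      have h1 : y ≤ x i := hxmax i y (hBs hy) hyi ⟨B, hBs, hBa, hBm, hy⟩
      exact (Finset.mem_filter.1 (hA's (hBA hy))).2 (Or.inr ⟨hyi, h1⟩)
    refine ⟨A, hAs.trans (Finset.erase_subset _ _), hAa,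
      fun z => if K z then m - 1 else f' z, ?_, ?_⟩
    · intro z hz
      rw [hAcard]
      by_cases hK : K z
      · simp only [hK, if_true]; omega
      · simp only [hK, if_false]
        exact (hf' z (Finset.mem_filter.2 ⟨hz, hK⟩)).trans hlt
    · intro z hz y hy hzy
      by_cases hKz : K z <;> by_cases hKy : K y
      · rcases hKz with h1 | h1 <;> rcases hKy with h2 | h2
        · left; rw [h1, h2]
        · right; rw [h1]; exact h2.2.trans hi
        · left; rw [h2]; exact h1.2.trans hi
        · by_cases hza : z = a
          · right; rw [hza]; exact h2.2.trans hi
          by_cases hya : y = a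
          · left; rw [hya]; exact h1.2.trans hi
          exact hfc z (Finset.mem_erase.2 ⟨hza, hz⟩) y (Finset.mem_erase.2 ⟨hya, hy⟩)
            (h1.1.trans h2.1.symm)
      · simp only [hKz, hKy, if_true, if_false] at hzy
        have := hf' y (Finset.mem_filter.2 ⟨hy, hKy⟩)
        omega
      · simp only [hKz, hKy, if_true, if_false] at hzy
        have := hf' z (Finset.mem_filter.2 ⟨hz, hKz⟩)
        omega
      · simp only [hKz, hKy, if_false] at hzy
        exact hfc' z (Finset.mem_filter.2 ⟨hz, hKz⟩) y (Finset.mem_filter.2 ⟨hy, hKy⟩) hzy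
  · push Not at hc
    have haA : a ∉ A := fun h => by simpa using hAs h
    refine ⟨insert a A, ?_, ?_, fun z => if z = a then m else f z, ?_, ?_⟩
    · exact Finset.insert_subset has (hAs.trans (Finset.erase_subset _ _))
    · intro p hp q hq hpq
      rw [Finset.mem_insert] at hp hq
      rcases hp with rfl | hp <;> rcases hq with rfl | hq
      · rfl
      · exact (hamax' q (Finset.mem_of_mem_erase (hAs hq)) hpq).symm
      · obtain ⟨i, -, rfl⟩ := Finset.mem_image.1 hp
        exact absurd hpq (hc i)
      · exact hAa p hp q hq hpq
    · intro z hz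
      rw [Finset.card_insert_of_notMem haA, hAcard]
      by_cases hza : z = a
      · simp [hza]
      · simp only [hza, if_false]
        have := hf z (Finset.mem_erase.2 ⟨hza, hz⟩)
        omega
    · intro z hz y hy hzy
      by_cases hza : z = a <;> by_cases hya : y = a
      · left; rw [hza, hya]
      · simp only [hza, hya, if_true, if_false] at hzy
        have := hf y (Finset.mem_erase.2 ⟨hya, hy⟩)
        omega
      · simp only [hza, hya, if_true, if_false] at hzy
        have := hf z (Finset.mem_erase.2 ⟨hza, hz⟩)
        omega
      · simp only [hza, hya, if_false] at hzy
        exact hfc z (Finset.mem_erase.2 ⟨hza, hz⟩) y (Finset.mem_erase.2 ⟨hya, hy⟩) hzy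

/-- The order whose chains are the consistent classes. -/
def thinOrder {W : Type*} (G : SimpleGraph W) (r : W → W → Prop) (hr : IsStrictTotalOrder W r) :
    PartialOrder W where
  le u v := u = v ∨ (r u v ∧ ∀ w, r v w → G.Adj u w → G.Adj v w)
  le_refl u := Or.inl rfl
  le_trans u v w := by
    rintro (rfl | ⟨h1, h2⟩) (rfl | ⟨h3, h4⟩)
    · exact Or.inl rfl
    · exact Or.inr ⟨h3, h4⟩
    · exact Or.inr ⟨h1, h2⟩
    · refine Or.inr ⟨_root_.trans h1 h3, fun z hz hu => h4 z hz (h2 z (_root_.trans h3 hz) hu)⟩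
  le_antisymm u v := by
    rintro (rfl | ⟨h1, h2⟩) (h | ⟨h3, h4⟩)
    · rfl
    · rfl
    · exact h.symm
    · exact absurd h3 (asymm h1)

theorem thin_antichain {W : Type*} [Finite W] (G : SimpleGraph W) (r : W → W → Prop)
    (hr : IsStrictTotalOrder W r) (k : ℕ) (hk : k ≤ Thinness G) :
    ∃ A : Finset W, k ≤ A.card ∧
      ∀ a ∈ A, ∀ b ∈ A, r a b → ∃ w, r b w ∧ G.Adj a w ∧ ¬ G.Adj b w := by
  classical
  have := Fintype.ofFinite W
  obtain ⟨A, -, hA, f, hf, hfc⟩ :=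
    @dilworth_aux W (thinOrder G r hr) _ (Finset.univ : Finset W) rfl
  refine ⟨A, hk.trans ?_, ?_⟩
  · apply Nat.sInf_le
    refine ⟨r, hr, fun z => ⟨f z, hf z (Finset.mem_univ z)⟩, ?_⟩
    intro u v w huv hvw hC huw
    have hC' : f u = f v := by simpa using hC
    rcases hfc u (Finset.mem_univ _) v (Finset.mem_univ _) hC' with (h | h) | (h | h)
    · exact h ▸ huw
    · exact h.2 w hvw huw
    · exact h ▸ huw
    · exact absurd huv (asymm h.1)
  · intro a ha b hb hab
    by_contra hcon
    push Not at hcon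
    have := hA a ha b hb (Or.inr ⟨hab, hcon⟩)
    subst this
    exact irrefl a hab

theorem isKThin_thinness {W : Type*} [Finite W] (G : SimpleGraph W) :
    IsKThin G (Thinness G) := by
  classical
  have := Fintype.ofFinite W
  apply Nat.sInf_mem (s := {k | IsKThin G k})
  let e := Fintype.equivFin W
  refine ⟨Fintype.card W, fun u v => e u < e v, ?_, e, ?_⟩
  · exact { trichotomous := fun a b h1 h2 => e.injective (le_antisymm (not_lt.1 h2) (not_lt.1 h1))
            irrefl := fun a => lt_irrefl _
            trans := fun a b c h1 h2 => lt_trans h1 h2 }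
  · intro u v w huv _ hC _
    rw [hC] at huv
    exact absurd huv (lt_irrefl _)

/-- `G` with all edges at `x` removed. -/
def Rem (G : SimpleGraph V) (x : V) : SimpleGraph V where
  Adj a b := G.Adj a b ∧ a ≠ x ∧ b ≠ x
  symm := ⟨fun _ _ h => ⟨h.1.symm, h.2.2, h.2.1⟩⟩
  loopless := ⟨fun _ h => G.loopless.irrefl _ h.1⟩

theorem reach_ind {G : SimpleGraph V} {P : V → Prop} {b : V} (hb : P b)
    (step : ∀ a c, G.Adj a c → G.Reachable c b → P c → P a) :
    ∀ {a}, G.Reachable a b → P a := by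
  rintro a ⟨w⟩
  induction w with
  | nil => exact hb
  | cons h q ih => exact step _ _ h ⟨q⟩ (ih hb step)

theorem rem_not_x {G : SimpleGraph V} {x v : V} (hv : v ≠ x) {a : V}
    (h : (Rem G x).Reachable a v) : a ≠ x :=
  reach_ind (G := Rem G x) (P := fun a => a ≠ x) hv (fun _ _ h _ _ => h.2.1) h

theorem rem_disj {G : SimpleGraph V} (hT : G.IsTree) {x v w : V} (hv : G.Adj x v)
    (hw : G.Adj x w) (hvw : v ≠ w) : ¬ (Rem G x).Reachable v w := by
  intro h
  have hb := isAcyclic_iff_forall_adj_isBridge.1 hT.isAcyclic hv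
  rw [isBridge_iff] at hb
  apply hb
  have h1 : (G.deleteEdges {s(x, v)}).Reachable v w := by
    refine h.mono ?_
    intro a b hab
    rw [deleteEdges_adj]
    refine ⟨hab.1, ?_⟩
    have := hab.2
    simp only [Set.mem_singleton_iff, Sym2.eq_iff]
    tauto
  have h2 : (G.deleteEdges {s(x, v)}).Adj x w := by
    rw [deleteEdges_adj]
    refine ⟨hw, ?_⟩
    have := hv.ne
    simp only [Set.mem_singleton_iff, Sym2.eq_iff]
    tauto
  exact h2.reachable.trans h1.symm

/-- A dangling piece inside the branch of `v` at `x`. -/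
structure Leg (G : SimpleGraph V) (k : ℕ) (x v : V) (S : Set V) : Prop where
  adj : G.Adj x v
  reach : ∀ s ∈ S, (Rem G x).Reachable s v
  nadj : ∀ c, ¬ (Rem G x).Reachable c v → ∀ s ∈ S, ¬ G.Adj c s
  thin : k ≤ Thinness (G.induce S)

theorem dangling_nbr {G : SimpleGraph V} {v u c s : V}
    (hs : s ∈ ((G.deleteEdges {s(v,u)}).connectedComponentMk u).supp) (hcs : G.Adj c s) :
    c ∈ ((G.deleteEdges {s(v,u)}).connectedComponentMk u).supp ∨ c = v := by
  by_cases he : s(c, s) = s(v, u)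
  · rw [Sym2.eq_iff] at he
    rcases he with h | h
    · exact Or.inr h.1
    · left; rw [h.1]; exact rfl
  · left
    have h : (G.deleteEdges {s(v,u)}).Adj c s := by
      rw [deleteEdges_adj]; exact ⟨hcs, he⟩
    rw [ConnectedComponent.mem_supp_iff, ConnectedComponent.eq] at hs ⊢
    exact h.reachable.trans hs

theorem dangling_reach {G : SimpleGraph V} (hT : G.IsTree) {x v u : V} (hxv : G.Adj x v)
    (hvu : G.Adj v u) (hux : u ≠ x) :
    ∀ s ∈ ((G.deleteEdges {s(v,u)}).connectedComponentMk u).supp, (Rem G x).Reachable s v := by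
  intro s hs
  rw [ConnectedComponent.mem_supp_iff, ConnectedComponent.eq] at hs
  have hb := isAcyclic_iff_forall_adj_isBridge.1 hT.isAcyclic hvu
  rw [isBridge_iff] at hb
  have hx : ¬ (G.deleteEdges {s(v,u)}).Reachable x u := by
    intro h
    have h2 : (G.deleteEdges {s(v, u)}).Adj v x := by
      rw [deleteEdges_adj]
      refine ⟨hxv.symm, ?_⟩
      have := hvu.ne
      have := hxv.ne
      simp only [Set.mem_singleton_iff, Sym2.eq_iff]
      tauto
    exact hb (h2.reachable.trans h)
  refine reach_ind (P := fun s => (Rem G x).Reachable s v) ?_ ?_ hs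
  · exact Adj.reachable (G := Rem G x) ⟨hvu.symm, hux, hxv.ne'⟩
  · intro a c hac hc ih
    have h : (Rem G x).Adj a c := by
      refine ⟨(deleteEdges_adj.1 hac).1, ?_, ?_⟩
      · rintro rfl; exact hx (hac.reachable.trans hc)
      · rintro rfl; exact hx hc
    exact h.reachable.trans ih

theorem leg_of_knbr {G : SimpleGraph V} (hT : G.IsTree) {k : ℕ} {x v : V}
    (h : KNeighbor G k x v) : ∃ S, Leg G k x v S := by
  obtain ⟨hxv, u, hvu, hux, hk⟩ := h
  refine ⟨_, hxv, dangling_reach hT hxv hvu hux, ?_, hk⟩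
  intro c hc s hs hcs
  rcases dangling_nbr hs hcs with h | h
  · exact hc (dangling_reach hT hxv hvu hux c h)
  · exact hc (h ▸ Reachable.refl _)

/-- Antichain with top element in a leg. -/
structure LegA (G : SimpleGraph V) (r : V → V → Prop) (k : ℕ) (x v : V) (A : Finset V) (p : V) :
    Prop where
  adj : G.Adj x v
  card : k ≤ A.card
  mem : p ∈ A
  top : ∀ a ∈ A, a = p ∨ r a p
  reach : ∀ s ∈ A, (Rem G x).Reachable s v
  nadj : ∀ c, ¬ (Rem G x).Reachable c v → ∀ s ∈ A, ¬ G.Adj c s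
  anti : ∀ a ∈ A, ∀ b ∈ A, r a b → ∃ w, r b w ∧ G.Adj a w ∧ ¬ G.Adj b w ∧
    ∀ c, ¬ (Rem G x).Reachable c v → ¬ G.Adj c w

theorem finset_top {r : V → V → Prop} (hr : IsStrictTotalOrder V r) (A : Finset V)
    (hA : A.Nonempty) : ∃ p ∈ A, ∀ a ∈ A, a = p ∨ r a p := by
  classical
  induction hA using Finset.Nonempty.cons_induction with
  | singleton a => exact ⟨a, by simp, by simp⟩
  | cons a s h hs ih =>
    obtain ⟨p, hp, hpt⟩ := ih
    rcases trichotomous_of r a p with h1 | h1 | h1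
    · refine ⟨p, by simp [hp], ?_⟩
      intro b hb
      rcases Finset.mem_cons.1 hb with rfl | hb
      · exact Or.inr h1
      · exact hpt b hb
    · exact absurd (h1 ▸ hp) h
    · refine ⟨a, by simp, ?_⟩
      intro b hb
      rcases Finset.mem_cons.1 hb with rfl | hb
      · exact Or.inl rfl
      · rcases hpt b hb with rfl | h2
        · exact Or.inr h1
        · exact Or.inr (_root_.trans h2 h1)

theorem Leg.legA [Finite V] {G : SimpleGraph V} {r : V → V → Prop}
    (hr : IsStrictTotalOrder V r) {k : ℕ} (hk : 0 < k) {x v : V} {S : Set V}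
    (h : Leg G k x v S) : ∃ A p, LegA G r k x v A p := by
  classical
  have hr' : IsStrictTotalOrder S (fun a b => r a b) :=
    { trichotomous := fun a b h1 h2 => by
        rcases trichotomous_of r (a : V) b with h | h | h
        · exact absurd h h1
        · exact Subtype.ext h
        · exact absurd h h2
      irrefl := fun a => irrefl (a : V)
      trans := fun a b c h1 h2 => _root_.trans h1 h2 }
  obtain ⟨A, hA, hanti⟩ := thin_antichain (G.induce S) _ hr' k h.thin
  let B : Finset V := A.map (Function.Embedding.subtype _)
  have hB : B.card = A.card := Finset.card_map _
  have hBS : ∀ b ∈ B, ∃ hb : b ∈ S, (⟨b, hb⟩ : S) ∈ A := by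
    intro b hb
    obtain ⟨y, hy, rfl⟩ := Finset.mem_map.1 hb
    exact ⟨y.2, hy⟩
  obtain ⟨p, hp, hpt⟩ := finset_top hr B (Finset.card_pos.1 (by omega))
  refine ⟨B, p, h.adj, by omega, hp, hpt, ?_, ?_, ?_⟩
  · intro s hs
    exact h.reach s (hBS s hs).1
  · intro c hc s hs
    exact h.nadj c hc s (hBS s hs).1
  · intro a ha b hb hab
    obtain ⟨ha1, ha2⟩ := hBS a ha
    obtain ⟨hb1, hb2⟩ := hBS b hb
    obtain ⟨w, hw1, hw2, hw3⟩ := hanti _ ha2 _ hb2 hab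
    exact ⟨w, hw1, hw2, hw3, fun c hc => h.nadj c hc w w.2⟩

theorem three_core {G : SimpleGraph V} (hT : G.IsTree) {r : V → V → Prop}
    (hr : IsStrictTotalOrder V r) {k : ℕ} (C : V → Fin k) (hC : Consistent G r C)
    {x v1 v2 v3 : V} (h12 : v1 ≠ v2) (h32 : v3 ≠ v2)
    {A1 A2 A3 : Finset V} {p1 p2 p3 : V} (L1 : LegA G r k x v1 A1 p1)
    (L2 : LegA G r k x v2 A2 p2) (L3 : LegA G r k x v3 A3 p3)
    (r12 : r p1 p2) (r23 : r p2 p3) : False := by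
  classical
  let Q : V → Prop := fun z => ¬ (Rem G x).Reachable z v2
  let P : V → Prop := fun z => r z p2
  have hQx : Q x := fun h => rem_not_x L2.adj.ne' h rfl
  -- no crossing edge outside the branch of v2
  by_cases hcross : ∃ a b, G.Adj a b ∧ Q a ∧ Q b ∧ P a ∧ ¬ P b
  · obtain ⟨a, b, hab, hQa, hQb, hPa, hPb⟩ := hcross
    have hbp : r p2 b := by
      rcases trichotomous_of r b p2 with h | h | h
      · exact absurd h hPb
      · exact absurd (L2.reach p2 L2.mem) (h ▸ hQb)
      · exact h
    have haA : a ∉ A2 := fun h => hQa (L2.reach a h)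
    have key : ∀ s ∈ A2, C s ≠ C a := by
      intro s hs hsa
      rcases trichotomous_of r s a with h | h | h
      · have hsp : r s p2 := _root_.trans h hPa
        obtain ⟨w, hw1, hw2, hw3, hw4⟩ := L2.anti s hs p2 L2.mem hsp
        exact hw4 a hQa (hC s a w h (_root_.trans hPa hw1) hsa hw2)
      · exact haA (h ▸ hs)
      · have hsb : r s b := by
          rcases L2.top s hs with rfl | h'
          · exact hbp
          · exact _root_.trans h' hbp
        exact L2.nadj b hQb s hs (hC a s b h hsb hsa.symm hab).symm
    have inj : Set.InjOn C (insert a A2 : Finset V) := by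
      have aux : ∀ s ∈ A2, ∀ t ∈ A2, C s = C t → ¬ r s t := by
        intro s hs t ht hst h
        obtain ⟨w, hw1, hw2, hw3, -⟩ := L2.anti s hs t ht h
        exact hw3 (hC s t w h hw1 hst hw2)
      intro s hs t ht hst
      rw [Finset.mem_coe, Finset.mem_insert] at hs ht
      rcases hs with rfl | hs <;> rcases ht with rfl | ht
      · rfl
      · exact absurd hst.symm (key t ht)
      · exact absurd hst (key s hs)
      · rcases trichotomous_of r s t with h | h | h
        · exact absurd h (aux s hs t ht hst)
        · exact h
        · exact absurd h (aux t ht s hs hst.symm)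
    have h1 := Finset.card_le_card (Finset.subset_univ ((insert a A2).image C))
    rw [Finset.card_image_of_injOn inj, Finset.card_insert_of_notMem haA, Finset.card_univ,
      Fintype.card_fin] at h1
    have := L2.card
    omega
  · push Not at hcross
    have br : ∀ v, G.Adj x v → v ≠ v2 → ∀ z, (Rem G x).Reachable z v → Q z := by
      intro v hv hne z hz hz2
      exact rem_disj hT hv L2.adj hne (hz.symm.trans hz2)
    have hx : P x := by
      have h1 : P v1 := reach_ind (G := Rem G x) (b := p1) (P := P) r12
        (fun a c hac hc hPc => by
          have hc1 := hc.trans (L1.reach p1 L1.mem)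
          exact hcross c a hac.1.symm (br v1 L1.adj h12 c hc1)
            (br v1 L1.adj h12 a (hac.reachable.trans hc1)) hPc) (L1.reach p1 L1.mem).symm
      exact hcross v1 x L1.adj.symm (br v1 L1.adj h12 _ (Reachable.refl _)) hQx h1
    have h3 : P v3 := hcross x v3 L3.adj hQx (br v3 L3.adj h32 _ (Reachable.refl _)) hx
    have hp3 : P p3 := reach_ind (G := Rem G x) (b := v3) (P := P) h3
      (fun a c hac hc hPc =>
        hcross c a hac.1.symm (br v3 L3.adj h32 c hc)
          (br v3 L3.adj h32 a (hac.reachable.trans hc)) hPc) (L3.reach p3 L3.mem)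
    exact asymm r23 hp3

theorem three_legs [Finite V] {G : SimpleGraph V} (hT : G.IsTree) {k : ℕ} (hk : Thinness G = k)
    {x v1 v2 v3 : V} (h12 : v1 ≠ v2) (h13 : v1 ≠ v3) (h23 : v2 ≠ v3) {S1 S2 S3 : Set V}
    (L1 : Leg G k x v1 S1) (L2 : Leg G k x v2 S2) (L3 : Leg G k x v3 S3) : False := by
  obtain ⟨r, hr, C, hC⟩ := isKThin_thinness G
  subst hk
  have hpos : 0 < Thinness G := lt_of_le_of_lt (Nat.zero_le _) (C x).2
  obtain ⟨A1, p1, M1⟩ := L1.legA hr hpos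
  obtain ⟨A2, p2, M2⟩ := L2.legA hr hpos
  obtain ⟨A3, p3, M3⟩ := L3.legA hr hpos
  have n12 : p1 ≠ p2 := by
    rintro rfl
    exact rem_disj hT M1.adj M2.adj h12 ((M1.reach _ M1.mem).symm.trans (M2.reach _ M2.mem))
  have n13 : p1 ≠ p3 := by
    rintro rfl
    exact rem_disj hT M1.adj M3.adj h13 ((M1.reach _ M1.mem).symm.trans (M3.reach _ M3.mem))
  have n23 : p2 ≠ p3 := by
    rintro rfl
    exact rem_disj hT M2.adj M3.adj h23 ((M2.reach _ M2.mem).symm.trans (M3.reach _ M3.mem))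
  have tri : ∀ a b, a ≠ b → r a b ∨ r b a := by
    intro a b hab
    rcases trichotomous_of r a b with h | h | h
    · exact Or.inl h
    · exact absurd h hab
    · exact Or.inr h
  rcases tri _ _ n12 with a | a <;> rcases tri _ _ n13 with b | b <;>
    rcases tri _ _ n23 with c | c
  · exact three_core hT hr C hC h12 h23.symm M1 M2 M3 a c
  · exact three_core hT hr C hC h13 h23 M1 M3 M2 b c
  · exact three_core hT hr C hC h12 h23.symm M1 M2 M3 a c
  · exact three_core hT hr C hC h13.symm h12.symm M3 M1 M2 b a
  · exact three_core hT hr C hC h12.symm h13.symm M2 M1 M3 a b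
  · exact three_core hT hr C hC h12.symm h13.symm M2 M1 M3 a b
  · exact three_core hT hr C hC h23 h13 M2 M3 M1 c b
  · exact three_core hT hr C hC h23.symm h12 M3 M2 M1 c a

theorem exists_parent {G : SimpleGraph V} (hG : G.Connected) {rt z : V} (hz : z ≠ rt) :
    ∃ p, G.Adj z p ∧ G.dist rt p + 1 = G.dist rt z := by
  obtain ⟨w, hw⟩ := hG.exists_walk_length_eq_dist z rt
  cases w with
  | nil => exact absurd rfl hz
  | @cons _ p _ h q =>
    refine ⟨p, h, ?_⟩
    have h1 := G.dist_le q
    have h2 := hG.dist_triangle (u := z) (v := p) (w := rt)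
    have h3 : G.dist z p = 1 := dist_eq_one_iff_adj.2 h
    rw [Walk.length_cons] at hw
    rw [G.dist_comm (u := rt), G.dist_comm (u := rt)]
    omega

theorem reach_root {G : SimpleGraph V} (hG : G.Connected) {rt x : V} (n : ℕ) :
    ∀ z, G.dist rt z = n → z ≠ x → n ≤ G.dist rt x → (Rem G x).Reachable z rt := by
  induction n with
  | zero =>
    intro z hz _ _
    rw [hG.dist_eq_zero_iff] at hz
    rw [hz]
  | succ n ih =>
    intro z hz hzx hn
    have hzr : z ≠ rt := by rintro rfl; simp at hz
    obtain ⟨p, hp, hd⟩ := exists_parent hG hzr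
    have hpx : p ≠ x := by rintro rfl; omega
    have h1 : (Rem G x).Adj z p := ⟨hp, hzx, hpx⟩
    exact h1.reachable.trans (ih p (by omega) hpx (by omega))

theorem critical_le [Fintype V] (G : SimpleGraph V) (hT : G.IsTree)
    (rt : V) (k : ℕ) (hk : Thinness G = k) (x y : V)
    (hx : {v | IsChild G rt x v ∧ KNeighbor G k x v}.ncard = 2)
    (hy : {v | IsChild G rt y v ∧ KNeighbor G k y v}.ncard = 2)
    (hd : G.dist rt y ≤ G.dist rt x) : x = y := by
  by_contra hxy
  have hG := hT.connected
  obtain ⟨v1, v2, hv12, hvs⟩ := Set.ncard_eq_two.1 hx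
  obtain ⟨w1, w2, hw12, hws⟩ := Set.ncard_eq_two.1 hy
  have hv1 : v1 ∈ {v | IsChild G rt x v ∧ KNeighbor G k x v} := by rw [hvs]; simp
  have hv2 : v2 ∈ {v | IsChild G rt x v ∧ KNeighbor G k x v} := by rw [hvs]; simp
  have hw1 : w1 ∈ {v | IsChild G rt y v ∧ KNeighbor G k y v} := by rw [hws]; simp
  have hw2 : w2 ∈ {v | IsChild G rt y v ∧ KNeighbor G k y v} := by rw [hws]; simp
  have hxr : x ≠ rt := by
    rintro rfl
    rw [dist_self, Nat.le_zero, hG.dist_eq_zero_iff] at hd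
    exact hxy hd
  obtain ⟨p, hp, hpd⟩ := exists_parent hG hxr
  have hyp : (Rem G x).Reachable y p :=
    (reach_root hG _ y rfl (Ne.symm hxy) hd).trans
      (reach_root hG _ p rfl hp.ne' (by omega)).symm
  obtain ⟨w, ⟨-, hyw, u, hwu, huy, hku⟩, hxw⟩ : ∃ w, (IsChild G rt y w ∧ KNeighbor G k y w) ∧
      ¬ (Rem G y).Reachable x w := by
    by_cases h : (Rem G y).Reachable x w1
    · exact ⟨w2, hw2, fun h2 => rem_disj hT hw1.1.1 hw2.1.1 hw12 (h.symm.trans h2)⟩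
    · exact ⟨w1, hw1, h⟩
  have hwx : w ≠ x := by rintro rfl; exact hxw (Reachable.refl _)
  have hwp : (Rem G x).Reachable w p :=
    (Adj.reachable (G := Rem G x) ⟨hyw.symm, hwx, Ne.symm hxy⟩).trans hyp
  have hcomp : ∀ s, (Rem G y).Reachable s w → (Rem G x).Reachable s p := fun s hs =>
    reach_ind (G := Rem G y) (b := w) (P := fun s => (Rem G x).Reachable s p) hwp
      (fun a c hac hc ih => by
        have h : (Rem G x).Adj a c := by
          refine ⟨hac.1, ?_, ?_⟩
          · rintro rfl; exact hxw (hac.reachable.trans hc)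
          · rintro rfl; exact hxw hc
        exact h.reachable.trans ih) hs
  have hS := dangling_reach hT hyw hwu huy
  have L3 : Leg G k x p _ := ⟨hp, fun s hs => hcomp s (hS s hs), by
    intro c hc s hs hcs
    rcases dangling_nbr hs hcs with h | h
    · exact hc (hcomp c (hS c h))
    · exact hc (h ▸ hwp), hku⟩
  obtain ⟨S1, L1⟩ := leg_of_knbr hT hv1.2
  obtain ⟨S2, L2⟩ := leg_of_knbr hT hv2.2
  have e1 := hv1.1.2
  have e2 := hv2.1.2
  exact three_legs hT hk hv12 (by rintro rfl; omega) (by rintro rfl; omega) L1 L2 L3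

theorem at_most_one_critical [Fintype V] (G : SimpleGraph V) (hT : G.IsTree)
    (rt : V) (k : ℕ) (hk : Thinness G = k) (x y : V)
    (hx : {v | IsChild G rt x v ∧ KNeighbor G k x v}.ncard = 2)
    (hy : {v | IsChild G rt y v ∧ KNeighbor G k y v}.ncard = 2) :
    x = y := by
  rcases le_total (G.dist rt y) (G.dist rt x) with h | h
  · exact critical_le G hT rt k hk x y hx hy h
  · exact (critical_le G hT rt k hk y x hy hx h).symm
end
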